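/- Let 1 ≤ m ≤ k and let λ, μ ∈ L^k(m,n). Define λ∧μ as the partition with parts min(λ_i, μ_i) and λ∨μ as the partition with parts max(λ_i, μ_i) (intersection and union of diagrams). Then λ∧μ and λ∨μ both lie in L^k(m,n), and they are respectively the greatest lower bound and the least upper bound of λ and μ in the poset (L^k(m,n), ≼). Hence L^k(m,n) is a lattice. -/

import Mathlib

/-- A partition: a weakly decreasing list of positive integers. -/
def IsPartition (l : List ℕ) : Prop :=
  l.Pairwise (· ≥ ·) ∧ ∀ x ∈ l, 0 < x

/-- The `i`-th part (0-indexed), with parts beyond the length equal to 0. -/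
def part (l : List ℕ) (i : ℕ) : ℕ := l.getD i 0

/-- Diagram containment `l ⊆ m`: every part of `l` is at most the corresponding part of `m`. -/
def SubDiag (l m : List ℕ) : Prop := ∀ i, part l i ≤ part m i

/-- A `k`-bounded partition: a partition whose first part is at most `k`. -/
def KBounded (k : ℕ) (l : List ℕ) : Prop := IsPartition l ∧ part l 0 ≤ k

/-- Hook length of the square `(i,j)` (0-indexed) with respect to the skew diagram
`outer/inner`: the number of cells `(i,j')` of the skew diagram with `j' ≥ j` plus the
number of cells `(i',j)` of the skew diagram with `i' > i`. -/
def hookLen (outer inner : List ℕ) (i j : ℕ) : ℕ :=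
  ((Finset.range (part outer i)).filter (fun j' => j ≤ j' ∧ part inner i ≤ j')).card +
  ((Finset.range outer.length).filter
    (fun i' => i < i' ∧ part inner i' ≤ j ∧ j < part outer i')).card

/-- `(outer, inner)` is the `k`-skew diagram of the `k`-bounded partition `l`:
row `i` of `outer/inner` has `l i` cells, every cell of `outer/inner` has hook length
at most `k`, and every square of the inner shape has hook length exceeding `k`. -/
def IsKSkew (k : ℕ) (l outer inner : List ℕ) : Prop :=
  IsPartition outer ∧ IsPartition inner ∧ SubDiag inner outer ∧
  (∀ i, part outer i - part inner i = part l i) ∧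
  (∀ i j, part inner i ≤ j → j < part outer i → hookLen outer inner i j ≤ k) ∧
  (∀ i j, j < part inner i → k < hookLen outer inner i j)

/-- Length of column `j` of the skew diagram `outer/inner`. -/
def colLen (outer inner : List ℕ) (j : ℕ) : ℕ :=
  ((Finset.range outer.length).filter
    (fun i => part inner i ≤ j ∧ j < part outer i)).card

/-- The list of column lengths of the skew diagram `outer/inner`. -/
def skewCols (outer inner : List ℕ) : List ℕ :=
  ((List.range (part outer 0)).map (colLen outer inner)).filter (fun x => decide (x ≠ 0))

/-- The `k`-conjugate of `l`: the partition whose parts are the column lengths of the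
(unique) `k`-skew diagram of `l`. -/
noncomputable def kConj (k : ℕ) (l : List ℕ) : List ℕ :=
  haveI := Classical.dec (∃ p : List ℕ × List ℕ, IsKSkew k l p.1 p.2)
  if h : ∃ p : List ℕ × List ℕ, IsKSkew k l p.1 p.2 then
    skewCols h.choose.1 h.choose.2
  else []

/-- The covering relation of the `k`-Young order on `k`-bounded partitions. -/
def KCover (k : ℕ) (l m : List ℕ) : Prop :=
  KBounded k l ∧ KBounded k m ∧ SubDiag l m ∧
  SubDiag (kConj k l) (kConj k m) ∧ m.sum = l.sum + 1

/-- The `k`-Young order: reflexive-transitive closure of the covering relation. -/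
def KLe (k : ℕ) : List ℕ → List ℕ → Prop := Relation.ReflTransGen (KCover k)

/-- The weakly decreasing rearrangement of the combined parts of two partitions. -/
def punion (l r : List ℕ) : List ℕ := (l ++ r).mergeSort (fun a b => decide (a ≥ b))

/-- The ordinary conjugate of a partition: the list of column lengths of its diagram. -/
def conj (l : List ℕ) : List ℕ :=
  (List.range (part l 0)).map (fun j => (l.filter (fun x => decide (j < x))).length)

/-- Intersection of diagrams: the partition with parts `min (λ_i, μ_i)`. -/
def pInter (l r : List ℕ) : List ℕ :=
  (List.range (min l.length r.length)).map (fun i => min (part l i) (part r i))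

/-- Union of diagrams: the partition with parts `max (λ_i, μ_i)`. -/
def pUnionDiag (l r : List ℕ) : List ℕ :=
  (List.range (max l.length r.length)).map (fun i => max (part l i) (part r i))

theorem part_cons_zero (x : ℕ) (l : List ℕ) : part (x :: l) 0 = x := rfl

theorem part_cons_succ (x : ℕ) (l : List ℕ) (i : ℕ) : part (x :: l) (i + 1) = part l i := by
  simp [part]

theorem part_nil (i : ℕ) : part [] i = 0 := by simp [part]

theorem part_eq_zero_of_length_le {l : List ℕ} {i : ℕ} (h : l.length ≤ i) : part l i = 0 := by
  exact List.getD_eq_default _ _ h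

theorem lt_length_of_part_pos {l : List ℕ} {i : ℕ} (h : 0 < part l i) : i < l.length := by
  by_contra hi
  rw [part_eq_zero_of_length_le (not_lt.mp hi)] at h
  exact lt_irrefl _ h

theorem part_eq_getElem {l : List ℕ} {i : ℕ} (h : i < l.length) : part l i = l[i] := by
  simp [part, h]

theorem IsPartition.part_pos {l : List ℕ} (hl : IsPartition l) {i : ℕ} (h : i < l.length) :
    0 < part l i := by
  rw [part_eq_getElem h]
  exact hl.2 _ (List.getElem_mem h)

theorem IsPartition.part_antitone {l : List ℕ} (hl : IsPartition l) : Antitone (part l) := by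
  intro i j hij
  rcases Nat.lt_or_ge j l.length with hj | hj
  · rcases hij.eq_or_lt with rfl | hij
    · exact le_rfl
    · rw [part_eq_getElem hj, part_eq_getElem (hij.trans hj)]
      exact List.pairwise_iff_getElem.mp hl.1 i j _ _ hij
  · rw [part_eq_zero_of_length_le hj]
    exact Nat.zero_le _

theorem IsPartition.ext {l l' : List ℕ} (hl : IsPartition l) (hl' : IsPartition l')
    (h : ∀ i, part l i = part l' i) : l = l' := by
  have hlen : l.length = l'.length := by
    apply le_antisymm <;> by_contra! hlt
    · have := hl.part_pos hlt
      rw [h, part_eq_zero_of_length_le le_rfl] at this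
      exact lt_irrefl _ this
    · have := hl'.part_pos hlt
      rw [← h, part_eq_zero_of_length_le le_rfl] at this
      exact lt_irrefl _ this
  refine List.ext_getElem hlen fun i h₁ h₂ => ?_
  rw [← part_eq_getElem h₁, ← part_eq_getElem h₂, h]

theorem part_map_range (f : ℕ → ℕ) (N i : ℕ) :
    part ((List.range N).map f) i = if i < N then f i else 0 := by
  split_ifs with h
  · rw [part_eq_getElem (by simpa using h)]
    simp
  · exact part_eq_zero_of_length_le (by simpa using h)

theorem isPartition_map_range {f : ℕ → ℕ} {N : ℕ} (hf : Antitone f) (hpos : ∀ i < N, 0 < f i) :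
    IsPartition ((List.range N).map f) := by
  refine ⟨?_, ?_⟩
  · rw [List.pairwise_map]
    exact List.pairwise_lt_range.imp fun h => hf h.le
  · simpa using hpos

theorem exists_isPartition_part_eq {f : ℕ → ℕ} (hf : Antitone f) {N : ℕ} (hN : f N = 0) :
    ∃ l, IsPartition l ∧ ∀ i, part l i = f i := by
  classical
  have hex : ∃ n, f n = 0 := ⟨N, hN⟩
  refine ⟨(List.range (Nat.find hex)).map f, isPartition_map_range hf fun i hi =>
    Nat.pos_of_ne_zero (Nat.find_min hex hi), fun i => ?_⟩
  rw [part_map_range]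
  split_ifs with h
  · rfl
  · have h₁ := hf (not_lt.mp h)
    rw [Nat.find_spec hex] at h₁
    omega

theorem sum_eq_sum_part : ∀ {l : List ℕ} {N : ℕ}, l.length ≤ N →
    l.sum = ∑ i ∈ Finset.range N, part l i
  | [], N, _ => by simp [part_nil]
  | x :: l, 0, h => by simp at h
  | x :: l, N + 1, h => by
    rw [Finset.sum_range_succ', List.sum_cons, sum_eq_sum_part (l := l) (N := N) (by simpa using h)]
    simp only [part_cons_succ, part_cons_zero]
    omega

theorem isPartition_replicate {m : ℕ} (hm : 1 ≤ m) (n : ℕ) : IsPartition (List.replicate n m) := by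
  refine ⟨List.pairwise_replicate.mpr (Or.inr le_rfl), fun x hx => ?_⟩
  rw [List.eq_of_mem_replicate hx]
  exact hm

theorem part_replicate (m n i : ℕ) :
    part (List.replicate n m) i = if i < n then m else 0 := by
  split_ifs with h
  · rw [part_eq_getElem (by simpa using h)]
    simp
  · exact part_eq_zero_of_length_le (by simpa using h)

theorem part_pInter {l r : List ℕ} (i : ℕ) : part (pInter l r) i = min (part l i) (part r i) := by
  rw [pInter, part_map_range]
  split_ifs with h
  · rfl
  · rcases min_le_iff.mp (not_lt.mp h) with h | h <;> simp [part_eq_zero_of_length_le h]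

theorem part_pUnionDiag {l r : List ℕ} (i : ℕ) :
    part (pUnionDiag l r) i = max (part l i) (part r i) := by
  rw [pUnionDiag, part_map_range]
  split_ifs with h
  · rfl
  · have h := max_le_iff.mp (not_lt.mp h)
    simp [part_eq_zero_of_length_le h.1, part_eq_zero_of_length_le h.2]

theorem IsPartition.pInter {l r : List ℕ} (hl : IsPartition l) (hr : IsPartition r) :
    IsPartition (pInter l r) :=
  isPartition_map_range (fun _ _ h => min_le_min (hl.part_antitone h) (hr.part_antitone h))
    fun _ hi => lt_min (hl.part_pos (lt_min_iff.mp hi).1) (hr.part_pos (lt_min_iff.mp hi).2)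

theorem IsPartition.pUnionDiag {l r : List ℕ} (hl : IsPartition l) (hr : IsPartition r) :
    IsPartition (pUnionDiag l r) :=
  isPartition_map_range (fun _ _ h => max_le_max (hl.part_antitone h) (hr.part_antitone h))
    fun _ hi => lt_max_iff.mpr ((lt_max_iff.mp hi).imp hl.part_pos hr.part_pos)

theorem card_row_filter (a b j : ℕ) :
    ((Finset.range a).filter (fun j' => j ≤ j' ∧ b ≤ j')).card = a - max j b := by
  rw [← Nat.card_Ico]
  congr 1
  ext x
  simp
  omega

theorem hookLen_cons_succ {x : ℕ} {out inn inn' : List ℕ}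
    (h : ∀ i, part inn' (i + 1) = part inn i) (i j : ℕ) :
    hookLen (x :: out) inn' (i + 1) j = hookLen out inn i j := by
  simp only [hookLen, List.length_cons, Finset.card_filter, part_cons_succ, h]
  rw [Finset.sum_range_succ' _ out.length]
  simp only [part_cons_succ, h, add_lt_add_iff_right]
  simp

theorem hookLen_cons_zero {x : ℕ} {out inn inn' : List ℕ}
    (h : ∀ i, part inn' (i + 1) = part inn i) (j : ℕ) :
    hookLen (x :: out) inn' 0 j = x - max j (part inn' 0) + colLen out inn j := by
  simp only [hookLen, colLen, card_row_filter, part_cons_zero, List.length_cons]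
  congr 1
  simp only [Finset.card_filter]
  rw [Finset.sum_range_succ' _ out.length]
  simp only [part_cons_succ, h]
  simp

theorem colLen_cons {x : ℕ} {out inn inn' : List ℕ}
    (h : ∀ i, part inn' (i + 1) = part inn i) (j : ℕ) :
    colLen (x :: out) inn' j =
      colLen out inn j + if part inn' 0 ≤ j ∧ j < x then 1 else 0 := by
  simp only [colLen, Finset.card_filter, List.length_cons]
  rw [Finset.sum_range_succ' _ out.length]
  simp only [part_cons_succ, h, part_cons_zero]
  congr

theorem colLen_eq_zero {out inn : List ℕ} (hout : IsPartition out) {j : ℕ}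
    (hj : part out 0 ≤ j) : colLen out inn j = 0 := by
  rw [colLen, Finset.card_eq_zero, Finset.filter_eq_empty_iff]
  rintro i - ⟨-, hi⟩
  have := hout.part_antitone (Nat.zero_le i)
  omega

/-- Every `k`-bounded partition has a `k`-skew diagram; its column lengths decrease. -/
theorem exists_isKSkew (k : ℕ) : ∀ l : List ℕ, KBounded k l →
    ∃ out inn, IsKSkew k l out inn ∧ Antitone (colLen out inn)
  | [], _ => by
    refine ⟨[], [], ⟨⟨by simp, by simp⟩, ⟨by simp, by simp⟩, fun i => le_rfl, ?_, ?_, ?_⟩, ?_⟩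
    · simp [part_nil]
    · simp [part_nil]
    · simp [part_nil]
    · intro i j _
      simp [colLen]
  | x :: l, ⟨⟨hs, hp⟩, hk⟩ => by
    rw [part_cons_zero] at hk
    have hx : 0 < x := hp x (by simp)
    have hl : IsPartition l := ⟨(List.pairwise_cons.mp hs).2, fun y hy => hp y (by simp [hy])⟩
    have hlx : part l 0 ≤ x :=
      (IsPartition.part_antitone ⟨hs, hp⟩ (Nat.zero_le 1)).trans_eq' (part_cons_succ x l 0).symm
    obtain ⟨out, inn, ⟨hout, hinn, hsub, hrow, hcell, hsq⟩, hanti⟩ :=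
      exists_isKSkew k l ⟨hl, hlx.trans hk⟩
    have hex : ∃ c, x + colLen out inn c ≤ k :=
      ⟨part out 0, by rw [colLen_eq_zero hout le_rfl]; exact hk⟩
    classical
    obtain ⟨c, hc, hmin⟩ : ∃ c, x + colLen out inn c ≤ k ∧ ∀ j < c, k < x + colLen out inn j :=
      ⟨Nat.find hex, Nat.find_spec hex, fun j hj => not_le.mp (Nat.find_min hex hj)⟩
    have hci : part inn 0 ≤ c := by
      by_contra! hlt
      have h₁ := hsq 0 c hlt
      have h₂ : hookLen out inn 0 c ≤ x + colLen out inn c := by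
        rw [hookLen, colLen, card_row_filter]
        refine add_le_add ?_ (Finset.card_le_card fun i => ?_)
        · have := hrow 0
          omega
        · simp only [Finset.mem_filter]
          tauto
      omega
    obtain ⟨inn', hinn', hz, hsucc⟩ : ∃ inn', IsPartition inn' ∧ part inn' 0 = c ∧
        ∀ i, part inn' (i + 1) = part inn i := by
      have ha : Antitone fun i => part (c :: inn) i := by
        apply antitone_nat_of_succ_le
        intro n
        rw [part_cons_succ]
        cases n with
        | zero => exact hci
        | succ n =>
          rw [part_cons_succ]
          exact hinn.part_antitone (Nat.le_add_right n 1)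
      obtain ⟨inn', h₁, h₂⟩ := exists_isPartition_part_eq ha (N := inn.length + 1)
        (by simp [part_eq_zero_of_length_le])
      exact ⟨inn', h₁, h₂ 0, fun i => by rw [h₂, part_cons_succ]⟩
    have hrow0 := hrow 0
    have hout0 : part out 0 ≤ c + x := by omega
    have hmem : ∀ y ∈ out, y ≤ c + x := by
      intro y hy
      obtain ⟨i, hi, rfl⟩ := List.getElem_of_mem hy
      rw [← part_eq_getElem hi]
      exact (hout.part_antitone (Nat.zero_le i)).trans hout0
    refine ⟨(c + x) :: out, inn', ⟨⟨List.pairwise_cons.mpr ⟨hmem, hout.1⟩, ?_⟩, hinn',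
      ?_, ?_, ?_, ?_⟩, ?_⟩
    · intro y hy
      rcases List.mem_cons.mp hy with rfl | hy
      · omega
      · exact hout.2 y hy
    · rintro (_ | i)
      · rw [hz, part_cons_zero]
        omega
      · rw [hsucc, part_cons_succ]
        exact hsub i
    · rintro (_ | i)
      · rw [hz, part_cons_zero, part_cons_zero]
        omega
      · rw [hsucc, part_cons_succ, part_cons_succ]
        exact hrow i
    · rintro (_ | i) j h₁ h₂
      · rw [hookLen_cons_zero hsucc, hz]
        rw [hz] at h₁
        have := hanti h₁
        omega
      · rw [hookLen_cons_succ hsucc]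
        rw [hsucc] at h₁
        rw [part_cons_succ] at h₂
        exact hcell i j h₁ h₂
    · rintro (_ | i) j h
      · rw [hookLen_cons_zero hsucc, hz]
        rw [hz] at h
        have := hmin j h
        omega
      · rw [hookLen_cons_succ hsucc]
        rw [hsucc] at h
        exact hsq i j h
    · apply antitone_nat_of_succ_le
      intro j
      rw [colLen_cons hsucc, colLen_cons hsucc, hz]
      have h₁ := hanti (Nat.le_add_right j 1)
      rcases Nat.lt_trichotomy (j + 1) c with h | h | h
      · split_ifs <;> omega
      · have := hmin j (by omega)
        rw [← h] at hc ⊢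
        split_ifs <;> omega
      · split_ifs <;> omega

theorem exists_kConj_eq {k : ℕ} {l : List ℕ} (hl : KBounded k l) :
    ∃ out inn, IsKSkew k l out inn ∧ kConj k l = skewCols out inn := by
  have h : ∃ p : List ℕ × List ℕ, IsKSkew k l p.1 p.2 := by
    obtain ⟨out, inn, h, -⟩ := exists_isKSkew k l hl
    exact ⟨(out, inn), h⟩
  exact ⟨h.choose.1, h.choose.2, h.choose_spec, by simp only [kConj, dif_pos h]⟩

/-- A partition with parts at most `m` and at most `r` parts smaller than `m`. -/
def FewShort (m r : ℕ) (l : List ℕ) : Prop :=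
  IsPartition l ∧ (∀ i, part l i ≤ m) ∧ ∀ i, part l i < m → part l (i + r) = 0

theorem exists_lt_iff_lt_part {l : List ℕ} (hl : IsPartition l) (j : ℕ) :
    ∃ t, ∀ i, i < t ↔ j < part l i := by
  classical
  have hex : ∃ i, part l i ≤ j := ⟨l.length, by simp [part_eq_zero_of_length_le]⟩
  refine ⟨Nat.find hex, fun i => ?_⟩
  rw [Nat.lt_find_iff]
  exact ⟨fun h => not_le.mp (h i le_rfl),
    fun h i' hi' => not_le.mpr (h.trans_le (hl.part_antitone hi'))⟩

theorem inner_eq_zero {k r : ℕ} {l out inn : List ℕ} (h : IsKSkew k l out inn) {i : ℕ}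
    (hk : part l i + r ≤ k) (hz : part l (i + r + 1) = 0) (hl : IsPartition l) :
    part inn i = 0 := by
  obtain ⟨hout, hinn, hsub, hrow, hcell, hsq⟩ := h
  by_contra hne
  have h₁ := hsq i 0 (Nat.pos_of_ne_zero hne)
  have h₂ : hookLen out inn i 0 ≤ part l i + r := by
    rw [hookLen, card_row_filter]
    refine add_le_add (by rw [← hrow i]; omega) ?_
    have : r = (Finset.Ioc i (i + r)).card := by simp
    rw [this]
    apply Finset.card_le_card
    intro i' hi'
    simp only [Finset.mem_filter, Finset.mem_Ioc] at hi' ⊢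
    refine ⟨hi'.2.1, ?_⟩
    by_contra! hlt
    have h₃ := hl.part_antitone (show i + r + 1 ≤ i' by omega)
    have h₄ := hrow i'
    omega
  omega

/-- In the `k`-skew diagram of a partition with few short rows, each row starts where the
row `k - m + 1` steps above it ends. -/
theorem FewShort.inner_eq {k m : ℕ} {l out inn : List ℕ} (hm : 1 ≤ m) (hmk : m ≤ k)
    (hl : FewShort m (k - m + 1) l) (h : IsKSkew k l out inn) (i : ℕ) :
    part inn i = part out (i + (k - m + 1)) := by
  obtain ⟨hp, hle, hshort⟩ := hl
  obtain ⟨r, hr⟩ : ∃ r, r = k - m + 1 := ⟨_, rfl⟩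
  rw [← hr] at hshort ⊢
  have key : ∀ d i, out.length ≤ i + d → part inn i = part out (i + r) := by
    have h' := h
    obtain ⟨hout, hinn, hsub, hrow, hcell, hsq⟩ := h'
    intro d
    induction d with
    | zero =>
      intro i hi
      have h₁ := hsub i
      rw [part_eq_zero_of_length_le (show out.length ≤ i by omega)] at h₁
      rw [part_eq_zero_of_length_le (show out.length ≤ i + r by omega)]
      omega
    | succ d ih =>
      intro i hi
      have hrowi := hrow i
      rcases (hle i).lt_or_eq with hlt | heq
      · have hz := hshort i hlt
        have h₀ : part inn i = 0 := by
          refine inner_eq_zero (r := r - 1) h (by omega) ?_ hp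
          rw [← hz]
          congr 1
          omega
        have h₁ := hinn.part_antitone (Nat.le_add_right i r)
        have h₂ := hrow (i + r)
        omega
      · rcases Nat.lt_trichotomy (part inn i) (part out (i + r)) with hlt | he | hgt
        · exfalso
          have hc := hcell i (part inn i) le_rfl (by omega)
          obtain ⟨t, ht⟩ := exists_lt_iff_lt_part hout (part inn i)
          rw [hookLen, card_row_filter] at hc
          have hr' : r = (Finset.Ico (t - r) t).card := by
            have := (ht (i + r)).mpr hlt
            simp
            omega
          have hsubset := Finset.card_le_card (s := Finset.Ico (t - r) t)
            (t := (Finset.range out.length).filter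
              (fun i' => i < i' ∧ part inn i' ≤ part inn i ∧ part inn i < part out i')) (by
            intro i' hi'
            have h₁ := (ht (i + r)).mpr hlt
            simp only [Finset.mem_filter, Finset.mem_Ico, Finset.mem_range] at hi' ⊢
            have h₂ := (ht i').mp hi'.2
            refine ⟨lt_length_of_part_pos (by omega), by omega, ?_, h₂⟩
            exact hinn.part_antitone (by omega))
          omega
        · exact he
        · exfalso
          have hc := hsq i (part out (i + r)) hgt
          rw [hookLen, card_row_filter] at hc
          have hsubset := Finset.card_le_card (t := Finset.Ioo i (i + r))
            (s := (Finset.range out.length).filter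
              (fun i' => i < i' ∧ part inn i' ≤ part out (i + r) ∧
                part out (i + r) < part out i')) (by
            intro i' hi'
            simp only [Finset.mem_filter, Finset.mem_Ioo, Finset.mem_range] at hi' ⊢
            refine ⟨hi'.2.1, ?_⟩
            by_contra! hge
            have := hout.part_antitone hge
            omega)
          rw [Nat.card_Ioo] at hsubset
          omega
  exact key out.length i (by omega)

theorem FewShort.colLen_eq {k m : ℕ} {l out inn : List ℕ} (hm : 1 ≤ m) (hmk : m ≤ k)
    (hl : FewShort m (k - m + 1) l) (h : IsKSkew k l out inn) {j t : ℕ}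
    (ht : ∀ i, i < t ↔ j < part out i) : colLen out inn j = min (k - m + 1) t := by
  have hIco : min (k - m + 1) t = (Finset.Ico (t - (k - m + 1)) t).card := by
    simp
    omega
  rw [hIco, colLen]
  congr 1
  ext i
  simp only [Finset.mem_filter, Finset.mem_Ico, Finset.mem_range, hl.inner_eq hm hmk h]
  have h₁ := ht i
  have h₂ := ht (i + (k - m + 1))
  constructor
  · rintro ⟨-, h₃, h₄⟩
    omega
  · rintro ⟨h₃, h₄⟩
    exact ⟨lt_length_of_part_pos (i := i) (by omega), by omega, by omega⟩

theorem FewShort.part_skewCols {k m : ℕ} {l out inn : List ℕ} (hm : 1 ≤ m) (hmk : m ≤ k)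
    (hl : FewShort m (k - m + 1) l) (h : IsKSkew k l out inn) (j : ℕ) :
    part (skewCols out inn) j = colLen out inn j := by
  rw [skewCols, List.filter_eq_self.mpr, part_map_range]
  · split_ifs with hj
    · rfl
    · exact (colLen_eq_zero h.1 (not_lt.mp hj)).symm
  · intro a ha
    simp only [List.mem_map, List.mem_range] at ha
    obtain ⟨j, hj, rfl⟩ := ha
    obtain ⟨t, ht⟩ := exists_lt_iff_lt_part h.1 j
    rw [hl.colLen_eq hm hmk h ht]
    have := (ht 0).mpr hj
    simp
    omega

theorem FewShort.kBounded {k m r : ℕ} {l : List ℕ} (hmk : m ≤ k) (hl : FewShort m r l) :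
    KBounded k l := ⟨hl.1, (hl.2.1 0).trans hmk⟩

theorem FewShort.outer_le {k m : ℕ} {l l' out inn out' inn' : List ℕ} (hm : 1 ≤ m) (hmk : m ≤ k)
    (hl : FewShort m (k - m + 1) l) (hl' : FewShort m (k - m + 1) l')
    (h : IsKSkew k l out inn) (h' : IsKSkew k l' out' inn') (hsub : SubDiag l l') :
    SubDiag out out' := by
  have key : ∀ d i, out.length ≤ i + d → part out i ≤ part out' i := by
    intro d
    induction d with
    | zero =>
      intro i hi
      rw [part_eq_zero_of_length_le (show out.length ≤ i by omega)]
      exact Nat.zero_le _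
    | succ d ih =>
      intro i hi
      have h₁ := ih (i + (k - m + 1)) (by omega)
      have h₂ := hl.inner_eq hm hmk h i
      have h₃ := hl'.inner_eq hm hmk h' i
      have h₄ := h.2.2.2.1 i
      have h₅ := h'.2.2.2.1 i
      have h₆ := hsub i
      have h₇ := h'.2.2.1 i
      omega
  exact fun i => key out.length i (by omega)

theorem FewShort.kConj_subDiag {k m : ℕ} {l l' : List ℕ} (hm : 1 ≤ m) (hmk : m ≤ k)
    (hl : FewShort m (k - m + 1) l) (hl' : FewShort m (k - m + 1) l') (hsub : SubDiag l l') :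
    SubDiag (kConj k l) (kConj k l') := by
  obtain ⟨out, inn, h, heq⟩ := exists_kConj_eq (hl.kBounded hmk)
  obtain ⟨out', inn', h', heq'⟩ := exists_kConj_eq (hl'.kBounded hmk)
  intro j
  rw [heq, heq', hl.part_skewCols hm hmk h, hl'.part_skewCols hm hmk h']
  obtain ⟨t, ht⟩ := exists_lt_iff_lt_part h.1 j
  obtain ⟨t', ht'⟩ := exists_lt_iff_lt_part h'.1 j
  rw [hl.colLen_eq hm hmk h ht, hl'.colLen_eq hm hmk h' ht']
  refine min_le_min le_rfl (not_lt.mp fun hlt => ?_)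
  have h₁ := (ht t').mp hlt
  have h₂ := hl.outer_le hm hmk hl' h h' hsub t'
  have h₃ := (ht' t').mpr (h₁.trans_le h₂)
  exact lt_irrefl _ h₃

theorem FewShort.part_kConj_le {k m : ℕ} {l : List ℕ} (hm : 1 ≤ m) (hmk : m ≤ k)
    (hl : FewShort m (k - m + 1) l) (j : ℕ) : part (kConj k l) j ≤ k - m + 1 := by
  obtain ⟨out, inn, h, heq⟩ := exists_kConj_eq (hl.kBounded hmk)
  obtain ⟨t, ht⟩ := exists_lt_iff_lt_part h.1 j
  rw [heq, hl.part_skewCols hm hmk h, hl.colLen_eq hm hmk h ht]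
  exact min_le_left _ _

theorem part_skewCols_zero {out inn : List ℕ} (h₀ : 0 < part out 0) (h : 0 < colLen out inn 0) :
    part (skewCols out inn) 0 = colLen out inn 0 := by
  obtain ⟨N, hN⟩ := Nat.exists_eq_succ_of_ne_zero h₀.ne'
  rw [skewCols, hN, List.range_succ_eq_map, List.map_cons,
    List.filter_cons_of_pos (by simpa using h.ne'), part_cons_zero]

theorem part_le_of_sum_eq_succ {l l' : List ℕ} (hsub : SubDiag l l') (hsum : l'.sum = l.sum + 1)
    {i : ℕ} (hi : part l i < part l' i) (j : ℕ) :
    part l' j ≤ part l j + if j = i then 1 else 0 := by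
  by_contra! hlt
  have hN : ∃ N, l.length ≤ N ∧ l'.length ≤ N ∧ i < N ∧ j < N :=
    ⟨l.length + l'.length + i + j + 1, by omega, by omega, by omega, by omega⟩
  obtain ⟨N, h₁, h₂, h₃, h₄⟩ := hN
  rw [sum_eq_sum_part h₁, sum_eq_sum_part h₂] at hsum
  have hle : ∑ x ∈ Finset.range N, (part l x + (if x = i then 1 else 0) + (if x = j then 1 else 0))
      ≤ ∑ x ∈ Finset.range N, part l' x := by
    refine Finset.sum_le_sum fun x _ => ?_
    have := hsub x
    by_cases hxi : x = i <;> by_cases hxj : x = j <;> subst_vars <;> simp_all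
  rw [Finset.sum_add_distrib, Finset.sum_add_distrib, Finset.sum_ite_eq_of_mem',
    Finset.sum_ite_eq_of_mem'] at hle
  · omega
  · simpa using h₄
  · simpa using h₃

theorem FewShort.of_kCover {k m : ℕ} {l l' : List ℕ} (hm : 1 ≤ m) (hmk : m ≤ k)
    (hl' : FewShort m (k - m + 1) l') (h : KCover k l l') : FewShort m (k - m + 1) l := by
  obtain ⟨hb, -, hsub, hconj, hsum⟩ := h
  have hp := hb.1
  refine ⟨hp, fun i => (hsub i).trans (hl'.2.1 i), fun i hi => ?_⟩
  by_contra hne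
  have hi' : part l' i = m := by
    have h₁ := hl'.2.1 i
    have h₂ := hl'.2.2 i
    have h₃ := hsub (i + (k - m + 1))
    omega
  have hle := part_le_of_sum_eq_succ hsub hsum (i := i) (by omega)
  have hz : part l (i + (k - m + 1) + 1) = 0 := by
    have h₁ := hle (i + 1)
    rw [if_neg (by omega)] at h₁
    have h₂ := hp.part_antitone (Nat.le_add_right i 1)
    have h₃ := hl'.2.2 (i + 1) (lt_of_le_of_lt h₁ (lt_of_le_of_lt h₂ hi))
    have h₄ := hsub (i + (k - m + 1) + 1)
    rw [show i + 1 + (k - m + 1) = i + (k - m + 1) + 1 by omega] at h₃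
    omega
  obtain ⟨out, inn, hskew, heq⟩ := exists_kConj_eq hb
  have hinn := inner_eq_zero hskew (i := i) (r := k - m + 1) (by omega) hz hp
  obtain ⟨hout, hinnp, hs, hrow, -, -⟩ := hskew
  have hcol : k - m + 2 ≤ colLen out inn 0 := by
    have hc : k - m + 2 = (Finset.Icc i (i + (k - m + 1))).card := by
      simp
      omega
    rw [hc, colLen]
    apply Finset.card_le_card
    intro x hx
    simp only [Finset.mem_filter, Finset.mem_Icc, Finset.mem_range] at hx ⊢
    have h₁ := hinnp.part_antitone hx.1
    have h₂ := hp.part_antitone hx.2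
    have h₃ := hrow x
    have h₄ : 0 < part out x := by omega
    exact ⟨lt_length_of_part_pos h₄, by omega, h₄⟩
  have h0 : 0 < part out 0 := by
    have h₁ := hrow (i + (k - m + 1))
    have h₂ := hout.part_antitone (Nat.zero_le (i + (k - m + 1)))
    omega
  have h₁ := hconj 0
  rw [heq, part_skewCols_zero h0 (by omega)] at h₁
  have h₂ := hl'.part_kConj_le hm hmk 0
  omega

theorem fewShort_replicate {m : ℕ} (hm : 1 ≤ m) (r n : ℕ) :
    FewShort m r (List.replicate n m) := by
  refine ⟨isPartition_replicate hm n, fun i => ?_, fun i => ?_⟩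
  · rw [part_replicate]
    split_ifs <;> omega
  · rw [part_replicate, part_replicate]
    split_ifs <;> omega

theorem FewShort.of_kLe {k m : ℕ} {l l' : List ℕ} (hm : 1 ≤ m) (hmk : m ≤ k)
    (hl' : FewShort m (k - m + 1) l') (h : KLe k l l') : FewShort m (k - m + 1) l := by
  induction h using Relation.ReflTransGen.head_induction_on with
  | refl => exact hl'
  | head hc _ ih => exact ih.of_kCover hm hmk hc

theorem SubDiag.trans {a b c : List ℕ} (h : SubDiag a b) (h' : SubDiag b c) : SubDiag a c :=
  fun i => (h i).trans (h' i)

theorem KLe.subDiag {k : ℕ} {l l' : List ℕ} (h : KLe k l l') : SubDiag l l' := by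
  induction h with
  | refl => exact fun _ => le_rfl
  | tail _ hc ih => exact ih.trans hc.2.2.1

/-- If `ν ⊊ l` both have few short rows, some removable cell of `l` outside `ν` leaves a
partition with few short rows. -/
theorem FewShort.exists_remove {m r : ℕ} {ν l : List ℕ} (hr : 1 ≤ r) (hν : FewShort m r ν)
    (hl : FewShort m r l) (hsub : SubDiag ν l) (hne : ν ≠ l) :
    ∃ l', FewShort m r l' ∧ SubDiag ν l' ∧ SubDiag l' l ∧ l.sum = l'.sum + 1 := by
  classical
  obtain ⟨i₀, hi₀⟩ : ∃ i, part ν i < part l i := by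
    by_contra! hall
    exact hne (hν.1.ext hl.1 fun i => le_antisymm (hsub i) (hall i))
  obtain ⟨i, hi, hmax⟩ : ∃ i, part ν i < part l i ∧ ∀ j, i < j → part ν j = part l j := by
    let P : ℕ → Prop := fun i => part ν i < part l i
    have hPl : i₀ ≤ l.length := (lt_length_of_part_pos (by omega)).le
    refine ⟨Nat.findGreatest P l.length, Nat.findGreatest_spec (P := P) hPl hi₀, fun j hj => ?_⟩
    by_contra hne
    have hlt : part ν j < part l j := lt_of_le_of_ne (hsub j) hne
    have hjl : j < l.length := lt_length_of_part_pos (by omega)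
    exact Nat.findGreatest_is_greatest hj hjl.le hlt
  have hanti : Antitone fun j => part l j - if j = i then 1 else 0 := by
    apply antitone_nat_of_succ_le
    intro j
    have h₁ := hl.1.part_antitone (Nat.le_add_right j 1)
    by_cases hj : j = i
    · subst hj
      have h₂ := hmax (j + 1) (by omega)
      have h₃ := hν.1.part_antitone (Nat.le_add_right j 1)
      simp
      omega
    · rw [if_neg hj]
      omega
  obtain ⟨l', hp', hpart⟩ := exists_isPartition_part_eq hanti (N := l.length)
    (by simp [part_eq_zero_of_length_le])
  have hsub' : SubDiag l' l := fun j => by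
    rw [hpart]
    omega
  refine ⟨l', ⟨hp', fun j => (hsub' j).trans (hl.2.1 j), fun j hj => ?_⟩, fun j => ?_, hsub', ?_⟩
  · have h₁ := hsub' (j + r)
    rw [hpart] at hj
    by_cases hji : j = i
    · subst hji
      have h₂ := hmax (j + r) (by omega)
      have h₃ := hν.2.2 j (hi.trans_le (hl.2.1 j))
      omega
    · rw [if_neg hji] at hj
      have h₂ := hl.2.2 j (by omega)
      omega
  · rw [hpart]
    have := hsub j
    split_ifs with hji
    · subst hji
      omega
    · omega
  · have hN : ∃ N, l.length ≤ N ∧ l'.length ≤ N ∧ i < N :=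
      ⟨l.length + l'.length + i + 1, by omega, by omega, by omega⟩
    obtain ⟨N, h₁, h₂, h₃⟩ := hN
    rw [sum_eq_sum_part h₁, sum_eq_sum_part h₂]
    have hs : ∑ j ∈ Finset.range N, part l j =
        ∑ j ∈ Finset.range N, (part l' j + if j = i then 1 else 0) := by
      refine Finset.sum_congr rfl fun j _ => ?_
      rw [hpart]
      split_ifs with hji
      · subst hji
        omega
      · omega
    rw [hs, Finset.sum_add_distrib, Finset.sum_ite_eq_of_mem' _ _ _ (by simpa using h₃)]

/-- Among partitions with few short rows, containment implies the `k`-Young order. -/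
theorem FewShort.kLe {k m : ℕ} {ν l : List ℕ} (hm : 1 ≤ m) (hmk : m ≤ k)
    (hν : FewShort m (k - m + 1) ν) (hl : FewShort m (k - m + 1) l) (hsub : SubDiag ν l) :
    KLe k ν l := by
  induction hs : l.sum generalizing l with
  | zero =>
    by_cases hne : ν = l
    · subst hne
      exact Relation.ReflTransGen.refl
    · obtain ⟨l', -, -, -, h⟩ := hν.exists_remove (by omega) hl hsub hne
      omega
  | succ s ih =>
    by_cases hne : ν = l
    · subst hne
      exact Relation.ReflTransGen.refl
    · obtain ⟨l', hl', h₁, h₂, h₃⟩ := hν.exists_remove (by omega) hl hsub hne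
      exact (ih hl' h₁ (by omega)).tail
        ⟨hl'.kBounded hmk, hl.kBounded hmk, h₂, hl'.kConj_subDiag hm hmk hl h₂, h₃⟩

theorem FewShort.pInter {m r : ℕ} {a b : List ℕ} (ha : FewShort m r a) (hb : FewShort m r b) :
    FewShort m r (pInter a b) := by
  refine ⟨ha.1.pInter hb.1, fun i => ?_, fun i => ?_⟩
  · rw [part_pInter]
    exact (min_le_left _ _).trans (ha.2.1 i)
  · rw [part_pInter, part_pInter]
    intro h
    rcases min_lt_iff.mp h with h | h
    · simp [ha.2.2 i h]
    · simp [hb.2.2 i h]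

theorem FewShort.pUnionDiag {m r : ℕ} {a b : List ℕ} (ha : FewShort m r a)
    (hb : FewShort m r b) : FewShort m r (pUnionDiag a b) := by
  refine ⟨ha.1.pUnionDiag hb.1, fun i => ?_, fun i => ?_⟩
  · rw [part_pUnionDiag]
    exact max_le (ha.2.1 i) (hb.2.1 i)
  · rw [part_pUnionDiag, part_pUnionDiag]
    intro h
    simp [ha.2.2 i (max_lt_iff.mp h).1, hb.2.2 i (max_lt_iff.mp h).2]

/-- for `λ, μ ∈ L^k(m,n)`, the intersection and union of diagrams lie in
`L^k(m,n)` and are respectively the meet and the join of `λ` and `μ` there; hence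
`L^k(m,n)` is a lattice. -/
theorem kIdeal_lattice (k m n : ℕ) (hm : 1 ≤ m) (hmk : m ≤ k) (lam μ : List ℕ)
    (hlam : KLe k lam (List.replicate n m)) (hμ : KLe k μ (List.replicate n m)) :
    KLe k (pInter lam μ) (List.replicate n m) ∧
    KLe k (pUnionDiag lam μ) (List.replicate n m) ∧
    KLe k (pInter lam μ) lam ∧ KLe k (pInter lam μ) μ ∧
    (∀ ν, KLe k ν (List.replicate n m) → KLe k ν lam → KLe k ν μ →
      KLe k ν (pInter lam μ)) ∧
    KLe k lam (pUnionDiag lam μ) ∧ KLe k μ (pUnionDiag lam μ) ∧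
    (∀ ν, KLe k ν (List.replicate n m) → KLe k lam ν → KLe k μ ν →
      KLe k (pUnionDiag lam μ) ν) := by
  have hR := fewShort_replicate hm (k - m + 1) n
  have hl := hR.of_kLe hm hmk hlam
  have hu := hR.of_kLe hm hmk hμ
  have hI := hl.pInter hu
  have hU := hl.pUnionDiag hu
  have hIl : SubDiag (pInter lam μ) lam := fun i => by
    rw [part_pInter]
    exact min_le_left _ _
  have hIu : SubDiag (pInter lam μ) μ := fun i => by
    rw [part_pInter]
    exact min_le_right _ _
  have hlU : SubDiag lam (pUnionDiag lam μ) := fun i => by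
    rw [part_pUnionDiag]
    exact le_max_left _ _
  have huU : SubDiag μ (pUnionDiag lam μ) := fun i => by
    rw [part_pUnionDiag]
    exact le_max_right _ _
  have hUle : ∀ ν, SubDiag lam ν → SubDiag μ ν → SubDiag (pUnionDiag lam μ) ν :=
    fun ν h₁ h₂ i => by
      rw [part_pUnionDiag]
      exact max_le (h₁ i) (h₂ i)
  have hleI : ∀ ν, SubDiag ν lam → SubDiag ν μ → SubDiag ν (pInter lam μ) :=
    fun ν h₁ h₂ i => by
      rw [part_pInter]
      exact le_min (h₁ i) (h₂ i)
  exact ⟨hI.kLe hm hmk hR (hIl.trans hlam.subDiag),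
    hU.kLe hm hmk hR (hUle _ hlam.subDiag hμ.subDiag),
    hI.kLe hm hmk hl hIl, hI.kLe hm hmk hu hIu,
    fun ν hν h₁ h₂ => (hR.of_kLe hm hmk hν).kLe hm hmk hI (hleI ν h₁.subDiag h₂.subDiag),
    hl.kLe hm hmk hU hlU, hu.kLe hm hmk hU huU,
    fun ν hν h₁ h₂ => hU.kLe hm hmk (hR.of_kLe hm hmk hν) (hUle ν h₁.subDiag h₂.subDiag)⟩
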